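/- Let t > k ≥ 3 be integers and 0 < γ < β(k,t), and set η = (γ/(2·(t−1)!)) · ∏_{s=k−1}^{t−1} (1 − C(s,k−1)·β(k,t)). There exists an integer n₀ = n₀(k,t,γ) such that for every k-graph H on n ≥ n₀ vertices with δ_{k−1}(H) ≥ (1 − β(k,t) + γ)·n and every vertex v ∈ V(H), one has |Ñ_{K_t^k,1,η}(v)| ≥ (d(k,t) + 2γ)·n. -/

import Mathlib

open Finset

/-- `A` is the vertex set of a copy of the hypergraph with vertex type `V` and edge set `EF`
inside the hypergraph on `Fin n` with edge set `E`. -/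
def IsCopy {n : ℕ} {V : Type} [Fintype V] [DecidableEq V] (E : Finset (Finset (Fin n)))
    (EF : Finset (Finset V)) (A : Finset (Fin n)) : Prop :=
  ∃ f : V ↪ Fin n, Finset.map f Finset.univ = A ∧ ∀ e ∈ EF, e.map f ∈ E

/-- The induced subhypergraph of `E` on `S` has an `F`-factor, where `F` has vertex type `V`
and edge set `EF`: there are pairwise vertex-disjoint copies of `F` covering exactly `S`. -/
def HasFactorOn {n : ℕ} {V : Type} [Fintype V] [DecidableEq V] (E : Finset (Finset (Fin n)))
    (EF : Finset (Finset V)) (S : Finset (Fin n)) : Prop :=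
  ∃ P : Finset (Finset (Fin n)), (∀ A ∈ P, IsCopy E EF A) ∧
    (P : Set (Finset (Fin n))).PairwiseDisjoint id ∧ P.biUnion id = S

/-- `x` is `(F, i, η)`-close to `y`. -/
def CloseTo {n : ℕ} {V : Type} [Fintype V] [DecidableEq V] (E : Finset (Finset (Fin n)))
    (EF : Finset (Finset V)) (i : ℕ) (η : ℝ) (x y : Fin n) : Prop :=
  η * (n : ℝ) ^ (i * Fintype.card V - 1) ≤
    (({S : Finset (Fin n) | S.card = i * Fintype.card V - 1 ∧ x ∉ S ∧ y ∉ S ∧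
      HasFactorOn E EF (insert x S) ∧ HasFactorOn E EF (insert y S)}).ncard : ℝ)

/-- `H` is `(F, i, η)`-closed. -/
def IsClosedGraph {n : ℕ} {V : Type} [Fintype V] [DecidableEq V] (E : Finset (Finset (Fin n)))
    (EF : Finset (Finset V)) (i : ℕ) (η : ℝ) : Prop :=
  ∀ x y : Fin n, x ≠ y → CloseTo E EF i η x y

/-- `Ñ_{F,i,η}(x)`: the set of vertices `(F, i, η)`-close to `x`. -/
def Ntilde {n : ℕ} {V : Type} [Fintype V] [DecidableEq V] (E : Finset (Finset (Fin n)))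
    (EF : Finset (Finset V)) (i : ℕ) (η : ℝ) (x : Fin n) : Set (Fin n) :=
  {y | CloseTo E EF i η x y}

/-- Degree of the set `T` in the `k`-graph with edge set `E`. -/
noncomputable def degOn {n : ℕ} (E : Finset (Finset (Fin n))) (k : ℕ) (T : Finset (Fin n)) : ℕ :=
  ({S : Finset (Fin n) | S.card = k - T.card ∧ Disjoint S T ∧ S ∪ T ∈ E}).ncard

/-- Edge set of the complete `k`-graph `K_t^k` on `Fin t`. -/
def cliqueEdges (t k : ℕ) : Finset (Finset (Fin t)) :=
  Finset.powersetCard k (Finset.univ : Finset (Fin t))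

/-- Edge set of the complete `k`-partite `k`-graph `K_k^k(m)` with parts of size `m`. -/
def multipartiteEdges (k m : ℕ) : Finset (Finset (Fin k × Fin m)) :=
  Finset.univ.filter (fun e : Finset (Fin k × Fin m) =>
    ∀ i : Fin k, (e.filter (fun v => v.1 = i)).card = 1)

/-- `β(k,t,l)` from the paper. -/
noncomputable def betaL (k t l : ℕ) : ℝ :=
  2 / ((t.choose (k - 1) : ℝ) + ((t - l - 1).choose (k - 1) : ℝ) + ((l + 1).choose (k - 1) : ℝ))

/-- The defining conditions for `l₀(k,t)` when `k ≥ 4`. -/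
def GoodL (k t l : ℕ) : Prop :=
  2 * (l + 1) ≤ t ∧
  betaL k t l ≤ 1 / (((t - 1).choose (k - 1) : ℝ) + (l.choose (k - 1) : ℝ)) ∧
  (0 < (2 * l + 1).choose (k - 1) →
    betaL k t l ≤ 1 / (2 * ((2 * l + 1).choose (k - 1) : ℝ)))

/-- `l₀(k,t)`: equal to `1` when `k = 3`, and the largest `l` satisfying `GoodL k t l`
when `k ≥ 4`. -/
noncomputable def l0 (k t : ℕ) : ℕ := if k = 3 then 1 else sSup {l | GoodL k t l}

/-- `β(k,t) = β(k,t,l₀(k,t))`. -/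
noncomputable def betaKT (k t : ℕ) : ℝ := betaL k t (l0 k t)

/-- `d(k,t) = 1 - C(t-1,k-1)·β(k,t)`. -/
noncomputable def dKT (k t : ℕ) : ℝ := 1 - ((t - 1).choose (k - 1) : ℝ) * betaKT k t

open Classical in
/-- A lower bound on the degree of `T`, as a bound on the number of non-neighbours. -/
lemma card_nonneighbours_le {n k : ℕ} (hk : 1 ≤ k) (E : Finset (Finset (Fin n))) (b : ℝ)
    (T : Finset (Fin n)) (hT : T.card = k - 1) (hdeg : (1 - b) * n ≤ (degOn E k T : ℝ)) :
    ((univ.filter fun y => ¬ (y ∉ T ∧ insert y T ∈ E)).card : ℝ) ≤ b * n := by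
  have hsub : degOn E k T ≤ (univ.filter fun y => y ∉ T ∧ insert y T ∈ E).card := by
    unfold degOn
    rw [← Finset.card_image_of_injective (univ.filter fun y => y ∉ T ∧ insert y T ∈ E)
      (Finset.singleton_injective (α := Fin n)),
      ← Set.ncard_coe_finset ((univ.filter fun y => y ∉ T ∧ insert y T ∈ E).image singleton)]
    apply Set.ncard_le_ncard _ (Finset.finite_toSet _)
    rintro S ⟨hS, hd, hE⟩
    have h1 : S.card = 1 := by omega
    obtain ⟨y, rfl⟩ := Finset.card_eq_one.mp h1
    simp only [coe_image, Set.mem_image, mem_coe, mem_filter, mem_univ, true_and]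
    exact ⟨y, ⟨Finset.disjoint_singleton_left.mp hd, by rwa [Finset.insert_eq]⟩, rfl⟩
  have h := Finset.card_filter_add_card_filter_not (s := (univ : Finset (Fin n)))
    (fun y => y ∉ T ∧ insert y T ∈ E)
  rw [Finset.card_univ, Fintype.card_fin] at h
  have h' : ((univ.filter fun y => y ∉ T ∧ insert y T ∈ E).card : ℝ) +
    ((univ.filter fun y => ¬ (y ∉ T ∧ insert y T ∈ E)).card : ℝ) = n := by exact_mod_cast h
  have h2 : (degOn E k T : ℝ) ≤ ((univ.filter fun y => y ∉ T ∧ insert y T ∈ E).card : ℝ) := by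
    exact_mod_cast hsub
  linarith

/-- All `k`-subsets of `A` are edges. -/
def SpansClique {n : ℕ} (E : Finset (Finset (Fin n))) (k : ℕ) (A : Finset (Fin n)) : Prop :=
  ∀ e ⊆ A, e.card = k → e ∈ E

lemma SpansClique.mono {n k : ℕ} {E : Finset (Finset (Fin n))} {A B : Finset (Fin n)}
    (h : SpansClique E k B) (hAB : A ⊆ B) : SpansClique E k A :=
  fun e he hc => h e (he.trans hAB) hc

lemma SpansClique.of_card_lt {n k : ℕ} {E : Finset (Finset (Fin n))} {A : Finset (Fin n)}
    (h : A.card < k) : SpansClique E k A :=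
  fun e he hc => by have := Finset.card_le_card he; omega

lemma SpansClique.hasFactorOn {n k t : ℕ} {E : Finset (Finset (Fin n))} {A : Finset (Fin n)}
    (h : SpansClique E k A) (hA : A.card = t) : HasFactorOn E (cliqueEdges t k) A := by
  refine ⟨{A}, ?_, by simp, by simp⟩
  intro B hB
  rw [Finset.mem_singleton] at hB
  subst hB
  have hmap : Finset.map (B.orderEmbOfFin hA).toEmbedding Finset.univ = B :=
    Finset.map_orderEmbOfFin_univ B hA
  refine ⟨(B.orderEmbOfFin hA).toEmbedding, hmap, fun e he => h _ ?_ ?_⟩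
  · conv_rhs => rw [← hmap]
    exact Finset.map_subset_map.mpr (Finset.subset_univ e)
  · rw [Finset.card_map]
    exact (Finset.mem_powersetCard.mp he).2

open Classical in
/-- The vertices extending `A` to a larger clique. -/
noncomputable def cliqueExtensions {n : ℕ} (E : Finset (Finset (Fin n))) (k : ℕ)
    (A : Finset (Fin n)) : Finset (Fin n) :=
  univ.filter fun y => y ∉ A ∧ SpansClique E k (insert y A)

lemma mem_cliqueExtensions {n k : ℕ} {E : Finset (Finset (Fin n))} {A : Finset (Fin n)}
    {y : Fin n} :
    y ∈ cliqueExtensions E k A ↔ y ∉ A ∧ SpansClique E k (insert y A) := by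
  simp [cliqueExtensions]

lemma le_card_cliqueExtensions_of_lt {n k : ℕ} (E : Finset (Finset (Fin n)))
    (A : Finset (Fin n)) (hA : A.card < k - 1) :
    (n : ℝ) - k ≤ ((cliqueExtensions E k A).card : ℝ) := by
  have hsub : Aᶜ ⊆ cliqueExtensions E k A := by
    intro y hy
    have hy' := Finset.mem_compl.mp hy
    refine mem_cliqueExtensions.mpr ⟨hy', SpansClique.of_card_lt ?_⟩
    rw [Finset.card_insert_of_notMem hy']
    omega
  have h1 := Finset.card_le_card hsub
  rw [Finset.card_compl, Fintype.card_fin] at h1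
  have h2 : n ≤ (cliqueExtensions E k A).card + k := by omega
  have h3 : (n : ℝ) ≤ ((cliqueExtensions E k A).card : ℝ) + k := by exact_mod_cast h2
  linarith

open Classical in
lemma le_card_cliqueExtensions {n k : ℕ} (hk : 2 ≤ k) (E : Finset (Finset (Fin n))) (b : ℝ)
    (hdeg : ∀ T : Finset (Fin n), T.card = k - 1 → (1 - b) * n ≤ (degOn E k T : ℝ))
    (A : Finset (Fin n)) (hA : k - 1 ≤ A.card) (hcl : SpansClique E k A) :
    (1 - (A.card.choose (k - 1) : ℝ) * b) * n ≤ ((cliqueExtensions E k A).card : ℝ) := by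
  have hsub : (cliqueExtensions E k A)ᶜ ⊆ (A.powersetCard (k - 1)).biUnion
      (fun T => univ.filter fun y => ¬ (y ∉ T ∧ insert y T ∈ E)) := by
    intro y hy
    by_contra hcon
    rw [Finset.mem_compl, mem_cliqueExtensions] at hy
    simp only [mem_biUnion, mem_powersetCard, mem_filter, mem_univ, true_and, not_exists,
      not_and] at hcon
    have hyA : y ∉ A := by
      intro hyA
      obtain ⟨T, hyT, hTA, hTc⟩ := Finset.exists_subsuperset_card_eq
        (Finset.singleton_subset_iff.mpr hyA) (n := k - 1) (by rw [card_singleton]; omega) hA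
      have := hcon T ⟨hTA, hTc⟩
      exact (by tauto : y ∉ T) (Finset.singleton_subset_iff.mp hyT)
    apply hy
    refine ⟨hyA, fun e he hc => ?_⟩
    by_cases hye : y ∈ e
    · have h1 : e.erase y ⊆ A := by
        intro z hz
        have := he (Finset.mem_of_mem_erase hz)
        exact (Finset.mem_insert.mp this).resolve_left (Finset.ne_of_mem_erase hz)
      have := hcon (e.erase y) ⟨h1, by rw [Finset.card_erase_of_mem hye, hc]⟩
      have h2 : insert y (e.erase y) ∈ E := by
        have h3 : y ∉ e.erase y := Finset.notMem_erase y e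
        tauto
      rwa [Finset.insert_erase hye] at h2
    · exact hcl e ((Finset.subset_insert_iff_of_notMem hye).mp he) hc
  have h1 : (((cliqueExtensions E k A)ᶜ.card : ℕ) : ℝ) ≤ (A.card.choose (k - 1) : ℝ) * (b * n) := by
    calc (((cliqueExtensions E k A)ᶜ.card : ℕ) : ℝ)
        ≤ ∑ T ∈ A.powersetCard (k - 1),
            ((univ.filter fun y => ¬ (y ∉ T ∧ insert y T ∈ E)).card : ℝ) := by
          exact_mod_cast (Finset.card_le_card hsub).trans Finset.card_biUnion_le
      _ ≤ ∑ T ∈ A.powersetCard (k - 1), b * n := by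
          apply Finset.sum_le_sum
          intro T hT
          have hTc := (Finset.mem_powersetCard.mp hT).2
          exact card_nonneighbours_le (by omega) E b T hTc (hdeg T hTc)
      _ = _ := by rw [Finset.sum_const, Finset.card_powersetCard, nsmul_eq_mul]
  have h2 := Finset.card_add_card_compl (cliqueExtensions E k A)
  rw [Fintype.card_fin] at h2
  have h3 : ((cliqueExtensions E k A).card : ℝ) + ((cliqueExtensions E k A)ᶜ.card : ℝ) = n := by
    exact_mod_cast h2
  linarith

open Classical in
/-- The `s`-sets forming a clique together with `v`. -/
noncomputable def cliqueLink {n : ℕ} (E : Finset (Finset (Fin n))) (k : ℕ) (v : Fin n)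
    (s : ℕ) : Finset (Finset (Fin n)) :=
  univ.filter fun S => S.card = s ∧ v ∉ S ∧ SpansClique E k (insert v S)

lemma mem_cliqueLink {n k : ℕ} {E : Finset (Finset (Fin n))} {v : Fin n} {s : ℕ}
    {S : Finset (Fin n)} :
    S ∈ cliqueLink E k v s ↔ S.card = s ∧ v ∉ S ∧ SpansClique E k (insert v S) := by
  simp [cliqueLink]

open Classical in
lemma card_cliqueLink_mul_le {n k : ℕ} (E : Finset (Finset (Fin n))) (v : Fin n) (s : ℕ) (m : ℝ)
    (hm : ∀ S ∈ cliqueLink E k v s, m ≤ ((cliqueExtensions E k (insert v S)).card : ℝ)) :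
    ((cliqueLink E k v s).card : ℝ) * m ≤ ((cliqueLink E k v (s + 1)).card : ℝ) * (s + 1 : ℕ) := by
  rw [← nsmul_eq_mul, ← nsmul_eq_mul]
  apply Finset.card_nsmul_le_card_nsmul (fun S S' : Finset (Fin n) => S ⊆ S')
  · intro S hS
    refine (hm S hS).trans ?_
    obtain ⟨hc, hv, hcl⟩ := mem_cliqueLink.mp hS
    rw [Nat.cast_le]
    apply Finset.card_le_card_of_injOn (fun y => insert y S)
    · intro y hy
      obtain ⟨hy1, hy2⟩ := mem_cliqueExtensions.mp hy
      rw [Finset.mem_insert, not_or] at hy1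
      rw [Finset.mem_coe, Finset.mem_bipartiteAbove, mem_cliqueLink]
      refine ⟨⟨by rw [Finset.card_insert_of_notMem hy1.2, hc], ?_, ?_⟩, Finset.subset_insert y S⟩
      · rw [Finset.mem_insert, not_or]
        exact ⟨fun h => hy1.1 h.symm, hv⟩
      · rwa [Finset.insert_comm]
    · intro y hy z hz hyz
      have hy1 := (mem_cliqueExtensions.mp hy).1
      rw [Finset.mem_insert, not_or] at hy1
      have hyz' : insert y S = insert z S := hyz
      have : y ∈ insert z S := hyz' ▸ Finset.mem_insert_self y S
      exact (Finset.mem_insert.mp this).resolve_right hy1.2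
  · intro S' hS'
    rw [Nat.cast_le]
    obtain ⟨hc, -, -⟩ := mem_cliqueLink.mp hS'
    calc _ ≤ (S'.powersetCard s).card := by
          apply Finset.card_le_card
          intro S hS
          rw [Finset.mem_bipartiteBelow] at hS
          exact Finset.mem_powersetCard.mpr ⟨hS.2, (mem_cliqueLink.mp hS.1).1⟩
      _ = s + 1 := by rw [Finset.card_powersetCard, hc, Nat.choose_succ_self_right]

lemma card_cliqueLink_zero {n k : ℕ} (hk : 2 ≤ k) (E : Finset (Finset (Fin n))) (v : Fin n) :
    (1 : ℝ) ≤ ((cliqueLink E k v 0).card : ℝ) := by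
  have : 0 < (cliqueLink E k v 0).card := by
    apply Finset.card_pos.mpr
    exact ⟨∅, mem_cliqueLink.mpr ⟨rfl, Finset.notMem_empty v,
      SpansClique.of_card_lt (by simp; omega)⟩⟩
  exact_mod_cast this

lemma pow_le_factorial_mul_card_cliqueLink {n k : ℕ} (hk : 2 ≤ k) (hkn : k ≤ n)
    (E : Finset (Finset (Fin n))) (v : Fin n) (s : ℕ) (hs : s ≤ k - 2) :
    ((n : ℝ) - k) ^ s ≤ (s.factorial : ℝ) * ((cliqueLink E k v s).card : ℝ) := by
  induction s with
  | zero => simpa using card_cliqueLink_zero hk E v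
  | succ s ih =>
    have hstep := card_cliqueLink_mul_le E v s ((n : ℝ) - k) (k := k) (by
      intro S hS
      obtain ⟨hc, hv, -⟩ := mem_cliqueLink.mp hS
      apply le_card_cliqueExtensions_of_lt
      rw [Finset.card_insert_of_notMem hv]
      omega)
    have h0 : (0 : ℝ) ≤ (n : ℝ) - k := by
      rw [sub_nonneg]; exact_mod_cast hkn
    calc ((n : ℝ) - k) ^ (s + 1) = ((n : ℝ) - k) ^ s * ((n : ℝ) - k) := pow_succ _ _
      _ ≤ ((s.factorial : ℝ) * ((cliqueLink E k v s).card : ℝ)) * ((n : ℝ) - k) := by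
          gcongr; exact ih (by omega)
      _ = (s.factorial : ℝ) * (((cliqueLink E k v s).card : ℝ) * ((n : ℝ) - k)) := by ring
      _ ≤ (s.factorial : ℝ) * (((cliqueLink E k v (s + 1)).card : ℝ) * (s + 1 : ℕ)) := by gcongr
      _ = _ := by rw [Nat.factorial_succ]; push_cast; ring

lemma prod_mul_le_factorial_mul_card_cliqueLink {n k : ℕ} (hk : 2 ≤ k) (hkn : k ≤ n)
    (E : Finset (Finset (Fin n))) (b : ℝ)
    (hdeg : ∀ T : Finset (Fin n), T.card = k - 1 → (1 - b) * n ≤ (degOn E k T : ℝ))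
    (v : Fin n) (i : ℕ)
    (hpos : ∀ j, k - 1 ≤ j → j < k - 1 + i → 0 ≤ 1 - (j.choose (k - 1) : ℝ) * b) :
    ((n : ℝ) - k) ^ (k - 2) * (∏ j ∈ Finset.Ico (k - 1) (k - 1 + i),
        (1 - (j.choose (k - 1) : ℝ) * b)) * (n : ℝ) ^ i ≤
      ((k - 2 + i).factorial : ℝ) * ((cliqueLink E k v (k - 2 + i)).card : ℝ) := by
  induction i with
  | zero => simpa using pow_le_factorial_mul_card_cliqueLink hk hkn E v (k - 2) le_rfl
  | succ i ih =>
    set c : ℝ := 1 - ((k - 1 + i).choose (k - 1) : ℝ) * b with hc_def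
    have hc0 : 0 ≤ c := hpos _ (by omega) (by omega)
    have hstep := card_cliqueLink_mul_le E v (k - 2 + i) (c * n) (k := k) (by
      intro S hS
      obtain ⟨hc, hv, hcl⟩ := mem_cliqueLink.mp hS
      have hcard : (insert v S).card = k - 1 + i := by
        rw [Finset.card_insert_of_notMem hv]
        omega
      have := le_card_cliqueExtensions hk E b hdeg (insert v S) (by omega) hcl
      rwa [hcard] at this)
    have ih' := ih (fun j h1 h2 => hpos j h1 (by omega))
    rw [← add_assoc (k - 1), Finset.prod_Ico_succ_top (by omega), ← add_assoc (k - 2),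
      Nat.factorial_succ]
    calc _ = (((n : ℝ) - k) ^ (k - 2) * (∏ j ∈ Finset.Ico (k - 1) (k - 1 + i),
              (1 - (j.choose (k - 1) : ℝ) * b)) * (n : ℝ) ^ i) * (c * n) := by
            rw [hc_def]; ring
      _ ≤ (((k - 2 + i).factorial : ℝ) * ((cliqueLink E k v (k - 2 + i)).card : ℝ)) * (c * n) := by
            gcongr
      _ = ((k - 2 + i).factorial : ℝ) *
            (((cliqueLink E k v (k - 2 + i)).card : ℝ) * (c * n)) := by ring
      _ ≤ ((k - 2 + i).factorial : ℝ) *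
            (((cliqueLink E k v (k - 2 + i + 1)).card : ℝ) * (k - 2 + i + 1 : ℕ)) := by gcongr
      _ = _ := by push_cast; ring

lemma half_mul_pow_le_sub_pow {n k m : ℕ} (hk : 1 ≤ k) (hm : m ≤ k) (hn : 2 * k ^ 2 ≤ n) :
    (n : ℝ) ^ m / 2 ≤ ((n : ℝ) - k) ^ m := by
  have hkR : (1 : ℝ) ≤ k := by exact_mod_cast hk
  have hmR : (m : ℝ) ≤ k := by exact_mod_cast hm
  have hnR : 2 * (k : ℝ) ^ 2 ≤ n := by exact_mod_cast hn
  have hn0 : (0 : ℝ) < n := by nlinarith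
  have h1 : (k : ℝ) / n ≤ 1 := by rw [div_le_one hn0]; nlinarith
  have hb := one_add_mul_le_pow (a := -((k : ℝ) / n)) (by linarith) m
  have h2 : (m : ℝ) * (k / n) ≤ 1 / 2 := by
    rw [← mul_div_assoc, div_le_iff₀ hn0]
    nlinarith
  have h3 : (n : ℝ) - k = n * (1 + -(k / n)) := by field_simp; ring
  rw [h3, mul_pow]
  have : (0 : ℝ) ≤ (n : ℝ) ^ m := by positivity
  nlinarith

lemma mul_pow_le_card_cliqueLink {n k t : ℕ} (hk : 2 ≤ k) (hkt : k < t) (hn : 2 * k ^ 2 ≤ n)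
    (E : Finset (Finset (Fin n))) (β b : ℝ) (hβb : b ≤ β)
    (hdeg : ∀ T : Finset (Fin n), T.card = k - 1 → (1 - b) * n ≤ (degOn E k T : ℝ))
    (v : Fin n)
    (hpos : ∀ j ∈ Finset.Icc (k - 1) (t - 1), 0 ≤ 1 - (j.choose (k - 1) : ℝ) * β) :
    1 / (2 * ((t - 1).factorial : ℝ)) * (∏ j ∈ Finset.Icc (k - 1) (t - 1),
        (1 - (j.choose (k - 1) : ℝ) * β)) * (n : ℝ) ^ (t - 1) ≤
      ((cliqueLink E k v (t - 1)).card : ℝ) := by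
  have hle : ∀ j : ℕ, 1 - (j.choose (k - 1) : ℝ) * β ≤ 1 - (j.choose (k - 1) : ℝ) * b := by
    intro j; gcongr
  have hkn : k ≤ n := by nlinarith
  have h := prod_mul_le_factorial_mul_card_cliqueLink hk hkn E b hdeg v (t - k + 1) (by
    intro j h1 h2
    exact (hpos j (Finset.mem_Icc.mpr ⟨h1, by omega⟩)).trans (hle j))
  have hset : Finset.Ico (k - 1) (k - 1 + (t - k + 1)) = Finset.Icc (k - 1) (t - 1) := by
    ext j; simp only [Finset.mem_Ico, Finset.mem_Icc]; omega
  rw [hset, show k - 2 + (t - k + 1) = t - 1 by omega] at h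
  have hprod := Finset.prod_le_prod hpos (fun j _ => hle j)
  have hprod0 := Finset.prod_nonneg hpos
  have hhalf := half_mul_pow_le_sub_pow (n := n) (k := k) (m := k - 2) (by omega) (by omega) hn
  have hpow : (n : ℝ) ^ (t - 1) = (n : ℝ) ^ (k - 2) * (n : ℝ) ^ (t - k + 1) := by
    rw [← pow_add]; congr 1; omega
  have hf : (0 : ℝ) < ((t - 1).factorial : ℝ) := by positivity
  have hmain : (n : ℝ) ^ (k - 2) / 2 * (∏ j ∈ Finset.Icc (k - 1) (t - 1),
      (1 - (j.choose (k - 1) : ℝ) * β)) * (n : ℝ) ^ (t - k + 1) ≤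
      ((t - 1).factorial : ℝ) * ((cliqueLink E k v (t - 1)).card : ℝ) := by
    refine le_trans ?_ h
    gcongr
    exact (by positivity : (0 : ℝ) ≤ (n : ℝ) ^ (k - 2) / 2).trans hhalf
  rw [← mul_le_mul_iff_right₀ hf]
  refine le_trans (le_of_eq ?_) hmain
  generalize ∏ j ∈ Finset.Icc (k - 1) (t - 1), (1 - (j.choose (k - 1) : ℝ) * β) = P
  rw [hpow]
  field_simp

lemma goodL_zero {k t : ℕ} (hk : 3 ≤ k) (hkt : k < t) : GoodL k t 0 := by
  have hC : 0 < (t - 1).choose (k - 1) := Nat.choose_pos (by omega)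
  have hle : (t - 1).choose (k - 1) ≤ t.choose (k - 1) := Nat.choose_le_choose _ (by omega)
  have hCR : (0 : ℝ) < ((t - 1).choose (k - 1) : ℝ) := by exact_mod_cast hC
  have hleR : ((t - 1).choose (k - 1) : ℝ) ≤ (t.choose (k - 1) : ℝ) := by exact_mod_cast hle
  have h0 : Nat.choose 0 (k - 1) = 0 := Nat.choose_eq_zero_of_lt (by omega)
  have h1 : Nat.choose 1 (k - 1) = 0 := Nat.choose_eq_zero_of_lt (by omega)
  refine ⟨by omega, ?_, ?_⟩
  · simp only [betaL, zero_add, h0, h1, Nat.cast_zero, add_zero, Nat.sub_zero]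
    rw [div_le_div_iff₀ (by positivity) hCR]
    linarith
  · simp [h1]

lemma choose_mul_betaKT_le_one {k t : ℕ} (hk : 3 ≤ k) (hkt : k < t) :
    ((t - 1).choose (k - 1) : ℝ) * betaKT k t ≤ 1 := by
  have hC : 0 < (t - 1).choose (k - 1) := Nat.choose_pos (by omega)
  have hCR : (0 : ℝ) < ((t - 1).choose (k - 1) : ℝ) := by exact_mod_cast hC
  by_cases h3 : k = 3
  · subst h3
    obtain ⟨r, rfl⟩ := Nat.exists_eq_add_of_lt hkt
    simp only [betaKT, l0, betaL, if_true]
    have e1 : (3 + r + 1).choose 2 = (3 + r) + (3 + r).choose 2 := by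
      rw [Nat.choose_succ_succ' (3 + r) 1, Nat.choose_one_right]
    have e2 : (3 + r).choose 2 = (2 + r) + (2 + r).choose 2 := by
      rw [show 3 + r = 2 + r + 1 by omega, Nat.choose_succ_succ' (2 + r) 1, Nat.choose_one_right]
    have h1 : (3 + r + 1 - 1).choose (3 - 1) = (3 + r).choose 2 := rfl
    have h2 : (3 + r + 1 - 1 - 1).choose (3 - 1) = (2 + r).choose 2 := by
      congr 1; omega
    have h4 : (3 + r + 1).choose (3 - 1) = (3 + r).choose 2 + (3 + r) := by
      rw [show 3 - 1 = 2 from rfl, e1]; omega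
    have h5 : Nat.choose (1 + 1) (3 - 1) = 1 := rfl
    rw [h1, h2, h4, h5, e2, mul_div_assoc', div_le_one (by positivity)]
    push_cast
    linarith
  · have hmem : sSup {l | GoodL k t l} ∈ {l | GoodL k t l} :=
      Nat.sSup_mem ⟨0, goodL_zero hk hkt⟩ ⟨t, fun l hl => by have := hl.1; omega⟩
    have h := hmem.2.1
    have hl0 : l0 k t = sSup {l | GoodL k t l} := if_neg h3
    rw [betaKT, hl0]
    rw [le_div_iff₀ (by positivity)] at h
    have hb : 0 ≤ betaL k t (sSup {l | GoodL k t l}) := by unfold betaL; positivity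
    have hc : (0 : ℝ) ≤ ((sSup {l | GoodL k t l}).choose (k - 1) : ℝ) := by positivity
    nlinarith

open Classical in
lemma card_filter_cliqueLink_le {n k t : ℕ} (ht : 1 ≤ t) (E : Finset (Finset (Fin n)))
    (η : ℝ) (v y : Fin n) (hy : y ∉ Ntilde E (cliqueEdges t k) 1 η v) :
    (((cliqueLink E k v (t - 1)).filter fun S => y ∈ cliqueExtensions E k S).card : ℝ) <
      η * (n : ℝ) ^ (t - 1) := by
  have h : ¬ CloseTo E (cliqueEdges t k) 1 η v y := hy
  unfold CloseTo at h
  rw [not_le, Fintype.card_fin, one_mul] at h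
  refine lt_of_le_of_lt ?_ h
  rw [Nat.cast_le, ← Set.ncard_coe_finset]
  apply Set.ncard_le_ncard _ (Set.toFinite _)
  intro S hS
  rw [Finset.mem_coe, Finset.mem_filter, mem_cliqueLink, mem_cliqueExtensions] at hS
  obtain ⟨⟨hc, hv, hvS⟩, hyS, hyc⟩ := hS
  refine ⟨hc, hv, hyS, hvS.hasFactorOn ?_, hyc.hasFactorOn ?_⟩
  · rw [Finset.card_insert_of_notMem hv]; omega
  · rw [Finset.card_insert_of_notMem hyS]; omega

/-- In a `k`-graph with minimum codegree at least `(1 - β(k,t) + γ) n`, every vertex has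
`(K_t^k, 1, η)`-closed neighbourhood of size at least `(d(k,t) + 2γ) n`, where
`η = (γ/(2(t-1)!))·∏_{s=k-1}^{t-1} (1 - C(s,k-1) β(k,t))`. -/
theorem Ntilde_large (k t : ℕ) (hk : 3 ≤ k) (hkt : k < t) (γ : ℝ)
    (hγ : 0 < γ) (hγβ : γ < betaKT k t) :
    ∃ n₀ : ℕ, ∀ n : ℕ, n₀ ≤ n →
      ∀ E : Finset (Finset (Fin n)), (∀ e ∈ E, e.card = k) →
      (∀ T : Finset (Fin n), T.card = k - 1 →
        (1 - betaKT k t + γ) * n ≤ (degOn E k T : ℝ)) →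
      ∀ v : Fin n,
        (dKT k t + 2 * γ) * n ≤
          ((Ntilde E (cliqueEdges t k) 1
              (γ / (2 * (Nat.factorial (t - 1) : ℝ)) *
                ∏ s ∈ Finset.Icc (k - 1) (t - 1),
                  (1 - (s.choose (k - 1) : ℝ) * betaKT k t)) v).ncard : ℝ) := by
  classical
  refine ⟨2 * k ^ 2, fun n hn E _ hdeg v => ?_⟩
  have hbeta0 : 0 < betaKT k t := hγ.trans hγβ
  have hCβ := choose_mul_betaKT_le_one hk hkt
  have hC3 : 3 ≤ (t - 1).choose (k - 1) := by
    calc 3 ≤ k.choose (k - 1) := by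
          rw [Nat.choose_symm_of_eq_add (show k = k - 1 + 1 by omega), Nat.choose_one_right]
          exact hk
      _ ≤ _ := Nat.choose_le_choose _ (by omega)
  have hC3R : (3 : ℝ) ≤ ((t - 1).choose (k - 1) : ℝ) := by exact_mod_cast hC3
  have hnpos : (0 : ℝ) < n := by
    have : 0 < n := lt_of_lt_of_le (by positivity) hn
    exact_mod_cast this
  have hdeg' : ∀ T : Finset (Fin n), T.card = k - 1 →
      (1 - (betaKT k t - γ)) * n ≤ (degOn E k T : ℝ) := by
    intro T hT
    have := hdeg T hT
    rwa [← sub_add]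
  have hpos : ∀ j ∈ Finset.Icc (k - 1) (t - 1),
      0 ≤ 1 - (j.choose (k - 1) : ℝ) * betaKT k t := by
    intro j hj
    have h1 : j.choose (k - 1) ≤ (t - 1).choose (k - 1) :=
      Nat.choose_le_choose _ (Finset.mem_Icc.mp hj).2
    have h2 : (j.choose (k - 1) : ℝ) ≤ ((t - 1).choose (k - 1) : ℝ) := by exact_mod_cast h1
    nlinarith
  have hlink := mul_pow_le_card_cliqueLink (by omega) hkt hn E (betaKT k t) (betaKT k t - γ)
    (by linarith) hdeg' v hpos
  set P : ℝ := ∏ s ∈ Finset.Icc (k - 1) (t - 1), (1 - (s.choose (k - 1) : ℝ) * betaKT k t)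
  set η : ℝ := γ / (2 * (Nat.factorial (t - 1) : ℝ)) * P with hη
  have hηle : η * (n : ℝ) ^ (t - 1) ≤ γ * ((cliqueLink E k v (t - 1)).card : ℝ) := by
    calc η * (n : ℝ) ^ (t - 1)
        = γ * (1 / (2 * (Nat.factorial (t - 1) : ℝ)) * P * (n : ℝ) ^ (t - 1)) := by
          rw [hη]; ring
      _ ≤ _ := by gcongr
  have hd : dKT k t = 1 - ((t - 1).choose (k - 1) : ℝ) * betaKT k t := rfl
  set X : Finset (Fin n) := univ.filter fun y => y ∈ Ntilde E (cliqueEdges t k) 1 η v with hX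
  have hXcard : (Ntilde E (cliqueEdges t k) 1 η v).ncard = X.card := by
    rw [← Set.ncard_coe_finset, hX]
    congr 1
    ext y
    simp
  rw [hXcard]
  by_contra! hlt
  set L := cliqueLink E k v (t - 1)
  have hne : Xᶜ.Nonempty := by
    rw [Finset.nonempty_iff_ne_empty, Ne, Finset.compl_eq_empty_iff]
    intro hu
    rw [hu, Finset.card_univ, Fintype.card_fin, hd] at hlt
    have h1 : 2 * γ ≤ ((t - 1).choose (k - 1) : ℝ) * betaKT k t := by nlinarith
    nlinarith
  have hext : ∀ S ∈ L, (dKT k t + 3 * γ) * n ≤ ((cliqueExtensions E k S).card : ℝ) := by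
    intro S hS
    obtain ⟨hc, hv, hcl⟩ := mem_cliqueLink.mp hS
    refine le_trans ?_ (le_card_cliqueExtensions (by omega) E _ hdeg' S (by omega)
      (hcl.mono (Finset.subset_insert v S)))
    rw [hc, hd]
    gcongr
    nlinarith
  have hlower : (L.card : ℝ) * ((dKT k t + 3 * γ) * n) ≤
      ∑ S ∈ L, ((cliqueExtensions E k S).card : ℝ) := by
    rw [← nsmul_eq_mul]
    exact Finset.card_nsmul_le_sum L _ _ hext
  have hswap : ∑ S ∈ L, ((cliqueExtensions E k S).card : ℝ) =
      ∑ y : Fin n, ((L.filter fun S => y ∈ cliqueExtensions E k S).card : ℝ) := by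
    have := Finset.sum_card_bipartiteAbove_eq_sum_card_bipartiteBelow (s := L)
      (t := (univ : Finset (Fin n))) (fun S y => y ∈ cliqueExtensions E k S)
    simp only [Finset.bipartiteAbove, Finset.bipartiteBelow, Finset.filter_univ_mem] at this
    exact_mod_cast this
  have hin : ∑ y ∈ X, ((L.filter fun S => y ∈ cliqueExtensions E k S).card : ℝ) ≤
      (X.card : ℝ) * L.card := by
    rw [← nsmul_eq_mul]
    apply Finset.sum_le_card_nsmul
    intro y _
    exact_mod_cast Finset.card_filter_le _ _
  have hout : ∑ y ∈ Xᶜ, ((L.filter fun S => y ∈ cliqueExtensions E k S).card : ℝ) <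
      (Xᶜ.card : ℝ) * (η * (n : ℝ) ^ (t - 1)) := by
    rw [← nsmul_eq_mul, ← Finset.sum_const]
    apply Finset.sum_lt_sum_of_nonempty hne
    intro y hy
    apply card_filter_cliqueLink_le (by omega)
    simpa [hX] using hy
  have hsplit := Finset.sum_add_sum_compl X
    (fun y => ((L.filter fun S => y ∈ cliqueExtensions E k S).card : ℝ))
  have hcompl : (Xᶜ.card : ℝ) ≤ n := by
    have := Finset.card_le_univ Xᶜ
    rw [Fintype.card_fin] at this
    exact_mod_cast this
  have hL0 : (0 : ℝ) ≤ L.card := by positivity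
  have h1 : (Xᶜ.card : ℝ) * (η * (n : ℝ) ^ (t - 1)) ≤ n * (γ * L.card) := by
    calc _ ≤ (Xᶜ.card : ℝ) * (γ * L.card) := by gcongr
      _ ≤ _ := by gcongr
  have h2 : (X.card : ℝ) * L.card ≤ ((dKT k t + 2 * γ) * n) * L.card := by gcongr
  nlinarith
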